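/- For an integer N ≥ 3 and ε > 0, define λ₁(N, ε) = Σ_{j=0}^{N−1} exp(−4 sin²(jπ/N)/ε) and λ₂(N, ε) = Σ_{j=0}^{N−1} exp(−4 sin²(jπ/N)/ε) cos(2jπ/N), and set a(N, ε) = (1/N)(1 − λ₂(N, ε)/λ₁(N, ε)). Then: (i) for every ε > 0, as N → ∞ the quantity N · a(N, ε) converges to L(ε) := 1 − ( ∫₀^π exp(−4 sin²(x)/ε) cos(2x) dx ) / ( ∫₀^π exp(−4 sin²(x)/ε) dx ); and (ii) L(ε)/ε → 1/4 as ε → 0⁺. -/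

import Mathlib

open Real Filter

lemma riemann_aux (f : ℝ → ℝ) (hf : Continuous f) :
    Tendsto (fun N : ℕ => (π / N) * ∑ j ∈ Finset.range N, f ((j : ℝ) * π / N)) atTop
      (nhds (∫ x in (0:ℝ)..π, f x)) := by
  rw [Metric.tendsto_atTop]
  intro e he
  have huc : UniformContinuousOn f (Set.Icc 0 π) :=
    isCompact_Icc.uniformContinuousOn_of_continuous hf.continuousOn
  rw [Metric.uniformContinuousOn_iff] at huc
  obtain ⟨d, hd, hfd⟩ := huc (e / 4) (by positivity)
  obtain ⟨N0, hN0⟩ := exists_nat_gt (π / d)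
  have hpi := Real.pi_pos
  have hpi4 := Real.pi_lt_four
  refine ⟨N0 + 1, fun N hN => ?_⟩
  have hNN : (N0 : ℝ) + 1 ≤ N := by exact_mod_cast hN
  have hNp : (0:ℝ) < N := by
    have : (0:ℝ) ≤ N0 := Nat.cast_nonneg _
    linarith
  have hh : π / N < d := by
    rw [div_lt_iff₀ hd] at hN0
    rw [div_lt_iff₀ hNp]
    nlinarith
  have hsum : ∑ j ∈ Finset.range N, ∫ x in ((j:ℝ) * π / N)..(((j + 1 : ℕ):ℝ) * π / N), f x
      = ∫ x in (0:ℝ)..π, f x := by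
    have := intervalIntegral.sum_integral_adjacent_intervals
      (f := f) (μ := MeasureTheory.volume) (a := fun j : ℕ => (j:ℝ) * π / N) (n := N)
      (fun k _ => hf.intervalIntegrable _ _)
    rw [this]
    congr 1
    · simp
    · field_simp
  rw [← hsum, Finset.mul_sum, Real.dist_eq, ← Finset.sum_sub_distrib]
  have hb : ∀ j ∈ Finset.range N, |π / N * f ((j:ℝ) * π / N) -
      ∫ x in ((j:ℝ) * π / N)..(((j + 1 : ℕ):ℝ) * π / N), f x| ≤ e / 4 * (π / N) := by
    intro j hj
    have hjN : ((j:ℝ) + 1) ≤ N := by exact_mod_cast Finset.mem_range.mp hj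
    have hj0 : (0:ℝ) ≤ j := Nat.cast_nonneg _
    have hlen : ((j + 1 : ℕ):ℝ) * π / N = (j:ℝ) * π / N + π / N := by push_cast; ring
    have hstep : 0 < π / N := by positivity
    have hend : (j:ℝ) * π / N + π / N ≤ π := by
      rw [← add_div, div_le_iff₀ hNp]; nlinarith
    have hst : 0 ≤ (j:ℝ) * π / N := by positivity
    rw [hlen]
    set a := (j:ℝ) * π / N
    set h := π / N
    have h1 : h * f a - ∫ x in a..(a+h), f x = ∫ x in a..(a+h), (f a - f x) := by
      rw [intervalIntegral.integral_sub (by simp) (hf.intervalIntegrable _ _)]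
      simp
    rw [h1]
    have := intervalIntegral.norm_integral_le_of_norm_le_const (a := a) (b := a + h)
      (f := fun x => f a - f x) (C := e/4) (by
        intro x hx
        rw [Set.uIoc_of_le (by linarith)] at hx
        have := hfd a ⟨hst, by linarith⟩ x ⟨by linarith [hx.1], by linarith [hx.2]⟩ (by
          rw [Real.dist_eq, abs_lt]; constructor <;> linarith [hx.1, hx.2])
        rw [Real.dist_eq] at this
        exact this.le)
    rw [add_sub_cancel_left, abs_of_pos hstep] at this
    exact this
  calc _ ≤ ∑ j ∈ Finset.range N, e / 4 * (π / N) :=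
        (Finset.abs_sum_le_sum_abs _ _).trans (Finset.sum_le_sum hb)
    _ = e / 4 * π := by simp; field_simp
    _ < e := by nlinarith

lemma cont_aux (ε : ℝ) (n : ℕ) :
    Continuous (fun x : ℝ => Real.sin x ^ n * Real.exp (-4 * Real.sin x ^ 2 / ε)) := by
  fun_prop

lemma contE (ε : ℝ) : Continuous (fun x : ℝ => Real.exp (-4 * Real.sin x ^ 2 / ε)) := by
  fun_prop

lemma Zpos (ε : ℝ) : 0 < ∫ x in (0:ℝ)..π, Real.exp (-4 * Real.sin x ^ 2 / ε) :=
  intervalIntegral.intervalIntegral_pos_of_pos ((contE ε).intervalIntegrable _ _)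
    (fun x => Real.exp_pos _) Real.pi_pos

lemma num_eq (ε : ℝ) :
    (∫ x in (0:ℝ)..π, Real.exp (-4 * Real.sin x ^ 2 / ε) * Real.cos (2 * x)) =
    (∫ x in (0:ℝ)..π, Real.exp (-4 * Real.sin x ^ 2 / ε)) -
    2 * ∫ x in (0:ℝ)..π, Real.sin x ^ 2 * Real.exp (-4 * Real.sin x ^ 2 / ε) := by
  rw [← intervalIntegral.integral_const_mul, ← intervalIntegral.integral_sub
    ((contE ε).intervalIntegrable _ _) (((cont_aux ε 2).const_mul 2).intervalIntegrable _ _)]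
  congr 1
  ext x
  rw [Real.cos_two_mul, Real.cos_sq']
  ring

lemma ibp (ε : ℝ) :
    (∫ x in (0:ℝ)..π, Real.exp (-4 * Real.sin x ^ 2 / ε)) -
    2 * (∫ x in (0:ℝ)..π, Real.sin x ^ 2 * Real.exp (-4 * Real.sin x ^ 2 / ε)) =
    8 / ε * ((∫ x in (0:ℝ)..π, Real.sin x ^ 2 * Real.exp (-4 * Real.sin x ^ 2 / ε)) -
      ∫ x in (0:ℝ)..π, Real.sin x ^ 4 * Real.exp (-4 * Real.sin x ^ 2 / ε)) := by
  have hd : ∀ x : ℝ, HasDerivAt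
      (fun x : ℝ => Real.sin x * Real.cos x * Real.exp (-4 * Real.sin x ^ 2 / ε))
      ((Real.exp (-4 * Real.sin x ^ 2 / ε) -
        2 * (Real.sin x ^ 2 * Real.exp (-4 * Real.sin x ^ 2 / ε))) -
        8 / ε * (Real.sin x ^ 2 * Real.exp (-4 * Real.sin x ^ 2 / ε) -
          Real.sin x ^ 4 * Real.exp (-4 * Real.sin x ^ 2 / ε))) x := by
    intro x
    have h1 := ((Real.hasDerivAt_sin x).mul (Real.hasDerivAt_cos x)).mul
      (((((Real.hasDerivAt_sin x).pow 2).const_mul (-4)).div_const ε).exp)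
    refine h1.congr_deriv ?_
    have hc : Real.cos x ^ 2 = 1 - Real.sin x ^ 2 := Real.cos_sq' x
    simp only [Pi.mul_apply, Pi.pow_apply]
    push_cast
    linear_combination (Real.exp (-4 * Real.sin x ^ 2 / ε) * (1 - 8 / ε * Real.sin x ^ 2)) * hc
  have c0 := contE ε
  have c2 := cont_aux ε 2
  have c4 := cont_aux ε 4
  have h := intervalIntegral.integral_eq_sub_of_hasDerivAt (a := 0) (b := π) (fun x _ => hd x)
    (by apply Continuous.intervalIntegrable; fun_prop)
  rw [intervalIntegral.integral_sub (by apply Continuous.intervalIntegrable; fun_prop)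
      (by apply Continuous.intervalIntegrable; fun_prop),
    intervalIntegral.integral_sub (by apply Continuous.intervalIntegrable; fun_prop)
      (by apply Continuous.intervalIntegrable; fun_prop),
    intervalIntegral.integral_const_mul, intervalIntegral.integral_const_mul,
    intervalIntegral.integral_sub (by apply Continuous.intervalIntegrable; fun_prop)
      (by apply Continuous.intervalIntegrable; fun_prop)] at h
  simp at h
  simp
  linarith

lemma Zlow (ε : ℝ) (h0 : 0 < ε) (h1 : ε ≤ 1) :
    Real.exp (-4) * √ε ≤ ∫ x in (0:ℝ)..π, Real.exp (-4 * Real.sin x ^ 2 / ε) := by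
  have hs : √ε ≤ 1 := Real.sqrt_le_one.mpr h1
  have hs0 : 0 ≤ √ε := Real.sqrt_nonneg _
  have hsq : √ε ^ 2 = ε := Real.sq_sqrt h0.le
  have a1 : (∫ x in (0:ℝ)..√ε, Real.exp (-4 * Real.sin x ^ 2 / ε)) ≤
      ∫ x in (0:ℝ)..π, Real.exp (-4 * Real.sin x ^ 2 / ε) := by
    apply intervalIntegral.integral_mono_interval le_rfl hs0 (by linarith [Real.pi_gt_three])
    · exact Filter.Eventually.of_forall fun x => (Real.exp_pos _).le
    · exact (contE ε).intervalIntegrable _ _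
  refine le_trans ?_ a1
  have a2 : (∫ x in (0:ℝ)..√ε, Real.exp (-4)) ≤
      ∫ x in (0:ℝ)..√ε, Real.exp (-4 * Real.sin x ^ 2 / ε) := by
    apply intervalIntegral.integral_mono_on hs0 (by simp) ((contE ε).intervalIntegrable _ _)
    intro x hx
    apply Real.exp_le_exp.mpr
    rw [le_div_iff₀ h0]
    have b1 : Real.sin x ≤ x := Real.sin_le hx.1
    have b2 : 0 ≤ Real.sin x :=
      Real.sin_nonneg_of_nonneg_of_le_pi hx.1 (by linarith [Real.pi_gt_three, hx.2])
    have b3 : Real.sin x ^ 2 ≤ √ε ^ 2 := pow_le_pow_left₀ b2 (b1.trans hx.2) 2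
    linarith
  simp only [intervalIntegral.integral_const, smul_eq_mul, sub_zero] at a2
  linarith

lemma Sup (ε : ℝ) (h0 : 0 < ε) (k : ℕ) (C : ℝ)
    (hk : ∀ y : ℝ, 0 ≤ y → y ^ k * Real.exp (-4 * y) ≤ C) :
    (∫ x in (0:ℝ)..π, Real.sin x ^ (2 * k) * Real.exp (-4 * Real.sin x ^ 2 / ε))
      ≤ C * ε ^ k * π := by
  have : (∫ x in (0:ℝ)..π, Real.sin x ^ (2 * k) * Real.exp (-4 * Real.sin x ^ 2 / ε)) ≤
      ∫ x in (0:ℝ)..π, C * ε ^ k := by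
    apply intervalIntegral.integral_mono_on Real.pi_pos.le
      ((cont_aux ε _).intervalIntegrable _ _) (by simp)
    intro x _
    have h := hk (Real.sin x ^ 2 / ε) (by positivity)
    have e1 : Real.sin x ^ (2 * k) = (Real.sin x ^ 2 / ε) ^ k * ε ^ k := by
      rw [← mul_pow, pow_mul]; congr 1; field_simp
    have e2 : -4 * Real.sin x ^ 2 / ε = -4 * (Real.sin x ^ 2 / ε) := by ring
    rw [e1, e2]
    calc _ = ((Real.sin x ^ 2 / ε) ^ k * Real.exp (-4 * (Real.sin x ^ 2 / ε))) * ε ^ k := by ring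
      _ ≤ _ := mul_le_mul_of_nonneg_right h (by positivity)
  simp only [intervalIntegral.integral_const, smul_eq_mul, sub_zero] at this
  linarith

lemma y1 (y : ℝ) (hy : 0 ≤ y) : y ^ 1 * Real.exp (-4 * y) ≤ 1 := by
  have : -4 * y = -(4 * y) := by ring
  rw [this, Real.exp_neg, ← div_eq_mul_inv, div_le_one (Real.exp_pos _)]
  have := Real.add_one_le_exp (4 * y)
  linarith

lemma y2 (y : ℝ) (hy : 0 ≤ y) : y ^ 2 * Real.exp (-4 * y) ≤ 1 := by
  have : -4 * y = -(4 * y) := by ring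
  rw [this, Real.exp_neg, ← div_eq_mul_inv, div_le_one (Real.exp_pos _)]
  have := Real.quadratic_le_exp_of_nonneg (x := 4 * y) (by linarith)
  nlinarith

/-- Asymptotics of the smallest positive eigenvalue `a(N,ε) = (1/N)(1 - λ₂/λ₁)` of
the H-matrix for equally spaced points on the circle: (i) `N·a(N,ε) → L(ε)` as
`N → ∞`, where `L(ε)` is the corresponding ratio of integrals, and
(ii) `L(ε)/ε → 1/4` as `ε → 0⁺`. -/
theorem stmt19 :
    (∀ ε : ℝ, 0 < ε →
      Tendsto (fun Nn : ℕ =>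
          (Nn : ℝ) * ((1 / (Nn : ℝ)) * (1 -
            (∑ j ∈ Finset.range Nn,
              Real.exp (-4 * Real.sin ((j : ℝ) * π / (Nn : ℝ)) ^ 2 / ε) *
                Real.cos (2 * (j : ℝ) * π / (Nn : ℝ))) /
            (∑ j ∈ Finset.range Nn,
              Real.exp (-4 * Real.sin ((j : ℝ) * π / (Nn : ℝ)) ^ 2 / ε)))))
        atTop
        (nhds (1 -
          (∫ x in (0:ℝ)..π, Real.exp (-4 * Real.sin x ^ 2 / ε) * Real.cos (2 * x)) /
          (∫ x in (0:ℝ)..π, Real.exp (-4 * Real.sin x ^ 2 / ε))))) ∧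
    Tendsto (fun ε : ℝ =>
        (1 -
          (∫ x in (0:ℝ)..π, Real.exp (-4 * Real.sin x ^ 2 / ε) * Real.cos (2 * x)) /
          (∫ x in (0:ℝ)..π, Real.exp (-4 * Real.sin x ^ 2 / ε))) / ε)
      (nhdsWithin 0 (Set.Ioi 0)) (nhds (1 / 4)) := by
  constructor
  · intro ε _
    have h1 := riemann_aux (fun x => Real.exp (-4 * Real.sin x ^ 2 / ε) * Real.cos (2 * x))
      (by fun_prop)
    have h2 := riemann_aux (fun x => Real.exp (-4 * Real.sin x ^ 2 / ε)) (by fun_prop)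
    refine ((h1.div h2 (Zpos ε).ne').const_sub 1).congr' ?_
    filter_upwards [eventually_gt_atTop 0] with N hN
    have hNp : (0:ℝ) < N := by exact_mod_cast hN
    have hc : π / (N:ℝ) ≠ 0 := (div_pos Real.pi_pos hNp).ne'
    simp only [Pi.div_apply]
    rw [mul_div_mul_left _ _ hc, ← mul_assoc, mul_one_div_cancel hNp.ne', one_mul]
    congr 2
    refine Finset.sum_congr rfl fun j _ => ?_
    congr 2
    ring
  · have hlim : Tendsto (fun ε : ℝ => (π * Real.exp 4) * √ε * 2)
        (nhdsWithin 0 (Set.Ioi 0)) (nhds 0) := by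
      have : Continuous (fun ε : ℝ => (π * Real.exp 4) * √ε * 2) := by fun_prop
      have h := (this.tendsto 0).mono_left (nhdsWithin_le_nhds (s := Set.Ioi 0))
      simpa using h
    rw [tendsto_iff_dist_tendsto_zero]
    refine squeeze_zero' (Eventually.of_forall fun _ => dist_nonneg) ?_ hlim
    have hIoc : Set.Ioc (0:ℝ) 1 ∈ nhdsWithin (0:ℝ) (Set.Ioi 0) := Ioc_mem_nhdsGT one_pos
    filter_upwards [hIoc] with ε hε
    obtain ⟨h0, h1⟩ := hε
    have hZ := Zpos ε
    have hi := ibp ε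
    have hl := Zlow ε h0 h1
    have hA := Sup ε h0 1 1 y1
    have hB := Sup ε h0 2 1 y2
    have hA0 : 0 ≤ ∫ x in (0:ℝ)..π, Real.sin x ^ 2 * Real.exp (-4 * Real.sin x ^ 2 / ε) :=
      intervalIntegral.integral_nonneg Real.pi_pos.le fun x _ => by positivity
    have hB0 : 0 ≤ ∫ x in (0:ℝ)..π, Real.sin x ^ 4 * Real.exp (-4 * Real.sin x ^ 2 / ε) :=
      intervalIntegral.integral_nonneg Real.pi_pos.le fun x _ => by positivity
    rw [num_eq]
    norm_num only [] at hA hB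
    set Z := ∫ x in (0:ℝ)..π, Real.exp (-4 * Real.sin x ^ 2 / ε)
    set A := ∫ x in (0:ℝ)..π, Real.sin x ^ 2 * Real.exp (-4 * Real.sin x ^ 2 / ε)
    set B := ∫ x in (0:ℝ)..π, Real.sin x ^ 4 * Real.exp (-4 * Real.sin x ^ 2 / ε)
    have hs0 : 0 < √ε := Real.sqrt_pos.mpr h0
    have hsq : √ε * √ε = ε := Real.mul_self_sqrt h0.le
    have hπ := Real.pi_pos
    have hi' : ε * Z - 2 * ε * A = 8 * (A - B) := by
      field_simp at hi
      linarith
    have e1 : (1 - (Z - 2 * A) / Z) / ε - 1 / 4 = (2 * B / ε - A / 2) / Z := by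
      field_simp
      linarith
    have hcan : Real.exp 4 * Real.exp (-4) = 1 := by rw [← Real.exp_add]; simp
    have hkey : ε * π ≤ (π * Real.exp 4 * √ε) * Z := by
      calc ε * π = (π * Real.exp 4 * √ε) * (Real.exp (-4) * √ε) := by
            linear_combination (-π) * hsq - π * √ε * √ε * hcan
        _ ≤ _ := mul_le_mul_of_nonneg_left hl (by positivity)
    have hBε : B / ε ≤ ε * π := by
      rw [div_le_iff₀ h0]; linarith
    have hBε0 : 0 ≤ B / ε := by positivity
    rw [Real.dist_eq, e1, abs_div, abs_of_pos hZ, div_le_iff₀ hZ, abs_le, mul_div_assoc]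
    constructor <;> linarith
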